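/- arXiv:2605.29748 — 4 statements merged into one kernel-verified Lean document; each statement's English description precedes it below -/
import Mathlib

section
/- Let S be a finite nonempty set, let f, μ̂ : S → ℝ, let r > 0 and 0 ≤ u ≤ r/4, and let f* ∈ ℝ satisfy f(j) ≤ f* and |μ̂(j) − f(j)| ≤ u for every j ∈ S. Suppose there exists b ∈ S with f* − f(b) ≤ r. Then every y ∈ S satisfying the retention inequality μ̂(y) + u ≥ μ̂(b) − u − r has gap f* − f(y) ≤ 3r. Moreover, if additionally S ⊆ X ⊆ ℝ^d, f extends to an L-Lipschitz function on X with respect to the ℓ∞ norm (with the same upper bound f* ≥ f on X), then every x ∈ X with ‖x − y‖_∞ ≤ r/L for such a surviving y satisfies f* − f(x) ≤ 4r. -/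
/-- **Gap control for survivors and for the next active region.**
`ℝ^d` carries the `ℓ∞` metric (the sup metric on `Fin d → ℝ`).  Let `S ⊆ X ⊆ ℝ^d` be a
finite nonempty set, `f, μ̂` real-valued, `r > 0`, `0 ≤ u ≤ r/4`, `f* ≥ f` on `X` (hence on
`S`) with `|μ̂ j − f j| ≤ u` on `S`, and suppose `b ∈ S` has gap `f* − f b ≤ r`.
Then every `y ∈ S` passing the retention test `μ̂ y + u ≥ μ̂ b − u − r` has gap
`f* − f y ≤ 3r`; moreover, if `f` is `L`-Lipschitz on `X` w.r.t. `ℓ∞`, every `x ∈ X` with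
`‖x − y‖∞ ≤ r/L` for such a surviving `y` has gap `f* − f x ≤ 4r`. -/
theorem gap_control_survivors {d : ℕ} (X : Set (Fin d → ℝ)) (S : Finset (Fin d → ℝ))
    (hS : S.Nonempty) (hSX : ↑S ⊆ X)
    (f μhat : (Fin d → ℝ) → ℝ) (L r u fstar : ℝ)
    (hL : 0 < L) (hr : 0 < r) (hu0 : 0 ≤ u) (hu : u ≤ r / 4)
    (hfle : ∀ x ∈ X, f x ≤ fstar)
    (hLip : ∀ x ∈ X, ∀ y ∈ X, |f x - f y| ≤ L * dist x y)
    (hconc : ∀ j ∈ S, |μhat j - f j| ≤ u)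
    (b : Fin d → ℝ) (hb : b ∈ S) (hbgap : fstar - f b ≤ r)
    (y : Fin d → ℝ) (hy : y ∈ S) (hret : μhat y + u ≥ μhat b - u - r) :
    fstar - f y ≤ 3 * r ∧ ∀ x ∈ X, dist x y ≤ r / L → fstar - f x ≤ 4 * r := by
  have hgap : fstar - f y ≤ 3 * r := by
    have hb' := abs_le.mp (hconc b hb)
    have hy' := abs_le.mp (hconc y hy)
    linarith [hb'.1, hy'.2]
  refine ⟨hgap, fun x hx hxy => ?_⟩
  have hdist : L * dist x y ≤ r := by
    rw [mul_comm]
    exact (le_div_iff₀ hL).mp hxy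
  have hlip := (abs_le.mp (hLip x hx y (hSX hy))).1
  linarith
end

section
/- Let X ⊆ [0,1]^d be Lebesgue-measurable and let f : X → ℝ be L-Lipschitz with respect to ℓ∞ and attain its maximum f*; set Δ(x) = f* − f(x) and X_r = {x ∈ X : Δ(x) ≤ r}. Fix an integer k ≥ 1 and let x_1, …, x_m ∈ X_{2^{-k}} \ X_{2^{-(k+1)}} be points whose pairwise ℓ∞-distances exceed 2^{-(k+2)}/L. Then: (i) the closed ℓ∞-balls B∞(x_i, 2^{-(k+3)}/L), i = 1, …, m, are pairwise disjoint; (ii) for every i and every y ∈ B∞(x_i, 2^{-(k+3)}/L) ∩ X one has 2^{-(k+1)} − 2^{-(k+3)} ≤ Δ(y) ≤ 2^{-k} + 2^{-(k+3)}, so that B∞(x_i, 2^{-(k+3)}/L) ∩ X ⊆ X_{2^{-(k-1)}} \ X_{2^{-(k+2)}}; and consequently (iii) vol( X_{2^{-(k-1)}} \ X_{2^{-(k+2)}} ) ≥ ∑_{i=1}^m vol( B∞(x_i, 2^{-(k+3)}/L) ∩ X ). -/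
open MeasureTheory

/-- **Disjoint thickened balls inside an enlarged gap annulus.**
`ℝ^d` carries the `ℓ∞` metric (the sup metric on `Fin d → ℝ`).  Let `X ⊆ [0,1]^d` be
measurable, `f : X → ℝ` an `L`-Lipschitz function (w.r.t. `ℓ∞`) attaining its maximum
`f*` at `x*`; set `Δ x = f* − f x` and `X_r = {x ∈ X : Δ x ≤ r}`.  Fix `k ≥ 1` and points
`x_1, …, x_m ∈ X_{2^{-k}} \ X_{2^{-(k+1)}}` with pairwise `ℓ∞`-distances `> 2^{-(k+2)}/L`.
Then (i) the closed balls `B∞(x_i, 2^{-(k+3)}/L)` are pairwise disjoint;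
(ii) every `y ∈ B∞(x_i, 2^{-(k+3)}/L) ∩ X` has
`2^{-(k+1)} − 2^{-(k+3)} ≤ Δ y ≤ 2^{-k} + 2^{-(k+3)}`, so this set is contained in
`X_{2^{-(k-1)}} \ X_{2^{-(k+2)}}`; and (iii) `vol(X_{2^{-(k-1)}} \ X_{2^{-(k+2)}})` is at
least the sum of the volumes `vol(B∞(x_i, 2^{-(k+3)}/L) ∩ X)`. -/
theorem disjoint_balls_in_annulus {d : ℕ} (hd : 0 < d) (X : Set (Fin d → ℝ))
    (hX : X ⊆ Set.Icc 0 1) (hXm : MeasurableSet X)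
    (f : (Fin d → ℝ) → ℝ) (L : ℝ) (hL : 0 < L)
    (hLip : ∀ x ∈ X, ∀ y ∈ X, |f x - f y| ≤ L * dist x y)
    (xstar : Fin d → ℝ) (hxstar : xstar ∈ X) (hmax : ∀ x ∈ X, f x ≤ f xstar)
    (Xr : ℝ → Set (Fin d → ℝ)) (hXr : ∀ r, Xr r = {x ∈ X | f xstar - f x ≤ r})
    (k : ℕ) (hk : 1 ≤ k) (m : ℕ) (x : Fin m → Fin d → ℝ)
    (hxin : ∀ i, x i ∈ Xr ((2:ℝ) ^ (-(k:ℤ))) \ Xr ((2:ℝ) ^ (-(k:ℤ) - 1)))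
    (hsep : ∀ i j, i ≠ j → (2:ℝ) ^ (-(k:ℤ) - 2) / L < dist (x i) (x j)) :
    (Set.univ : Set (Fin m)).Pairwise (fun i j =>
        Disjoint (Metric.closedBall (x i) ((2:ℝ) ^ (-(k:ℤ) - 3) / L))
          (Metric.closedBall (x j) ((2:ℝ) ^ (-(k:ℤ) - 3) / L))) ∧
    (∀ i, ∀ y ∈ Metric.closedBall (x i) ((2:ℝ) ^ (-(k:ℤ) - 3) / L) ∩ X,
        (2:ℝ) ^ (-(k:ℤ) - 1) - (2:ℝ) ^ (-(k:ℤ) - 3) ≤ f xstar - f y ∧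
          f xstar - f y ≤ (2:ℝ) ^ (-(k:ℤ)) + (2:ℝ) ^ (-(k:ℤ) - 3)) ∧
    (∀ i, Metric.closedBall (x i) ((2:ℝ) ^ (-(k:ℤ) - 3) / L) ∩ X ⊆
        Xr ((2:ℝ) ^ (-(k:ℤ) + 1)) \ Xr ((2:ℝ) ^ (-(k:ℤ) - 2))) ∧
    (∑ i : Fin m, volume (Metric.closedBall (x i) ((2:ℝ) ^ (-(k:ℤ) - 3) / L) ∩ X)) ≤
      volume (Xr ((2:ℝ) ^ (-(k:ℤ) + 1)) \ Xr ((2:ℝ) ^ (-(k:ℤ) - 2))) := by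
  have hpos : (0:ℝ) < 2 ^ (-(k:ℤ)) := by positivity
  have h1 : (2:ℝ) ^ (-(k:ℤ) - 1) = 2 ^ (-(k:ℤ)) / 2 := by
    rw [zpow_sub₀ two_ne_zero]; norm_num
  have h2 : (2:ℝ) ^ (-(k:ℤ) - 2) = 2 ^ (-(k:ℤ)) / 4 := by
    rw [zpow_sub₀ two_ne_zero]; norm_num
  have h3 : (2:ℝ) ^ (-(k:ℤ) - 3) = 2 ^ (-(k:ℤ)) / 8 := by
    rw [zpow_sub₀ two_ne_zero]; norm_num
  have h4 : (2:ℝ) ^ (-(k:ℤ) + 1) = 2 ^ (-(k:ℤ)) * 2 := by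
    rw [zpow_add₀ two_ne_zero]; norm_num
  rw [h1] at hxin
  rw [h2] at hsep
  rw [h1, h2, h3, h4]
  generalize (2:ℝ) ^ (-(k:ℤ)) = r at *
  have hdisj : ∀ i j, i ≠ j → Disjoint (Metric.closedBall (x i) (r / 8 / L))
      (Metric.closedBall (x j) (r / 8 / L)) := fun i j hij =>
    Metric.closedBall_disjoint_closedBall <| by
      have hradii : r / 8 / L + r / 8 / L = r / 4 / L := by ring
      rw [hradii]
      exact hsep i j hij
  have hgap : ∀ i, ∀ y ∈ Metric.closedBall (x i) (r / 8 / L) ∩ X,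
      r / 2 - r / 8 ≤ f xstar - f y ∧ f xstar - f y ≤ r + r / 8 := by
    rintro i y ⟨hy, hyX⟩
    have hxi := hxin i
    simp only [hXr, Set.mem_sdiff, Set.mem_ofPred_eq, not_and, not_le] at hxi
    obtain ⟨⟨hxX, hupper⟩, hlower⟩ := hxi
    have hdist : L * dist y (x i) ≤ r / 8 := by
      have := mul_le_mul_of_nonneg_left (Metric.mem_closedBall.mp hy) hL.le
      rwa [mul_div_cancel₀ _ hL.ne'] at this
    have := abs_le.mp ((hLip y hyX _ hxX).trans hdist)
    have := hlower hxX
    constructor <;> linarith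
  have hsub : ∀ i, Metric.closedBall (x i) (r / 8 / L) ∩ X ⊆ Xr (r * 2) \ Xr (r / 4) := by
    intro i y hy
    have := hgap i y hy
    simp only [hXr, Set.mem_sdiff, Set.mem_ofPred_eq, not_and, not_le]
    exact ⟨⟨hy.2, by linarith⟩, fun _ => by linarith⟩
  refine ⟨fun i _ j _ hij => hdisj i j hij, hgap, hsub, ?_⟩
  rw [← tsum_fintype (L := .unconditional _), ← measure_iUnion
    (fun i j hij => (hdisj i j hij).mono Set.inter_subset_left Set.inter_subset_left)
    fun i => Metric.isClosed_closedBall.measurableSet.inter hXm]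
  exact measure_mono (Set.iUnion_subset hsub)
end

section
/- Let X ⊆ [0,1]^d and let f : X → ℝ be L-Lipschitz with respect to ℓ∞ and attain its maximum f*; set Δ(x) = f* − f(x), X_r = {x ∈ X : Δ(x) ≤ r} and X* = {x ∈ X : f(x) = f*}. Define the zooming dimension d_z := inf{ a ≥ 0 : ∃ C > 0 such that for all r ∈ (0,1], M( X_r \ X_{r/2}, r/16 ) ≤ C r^{-a} } and the optimal-set dimension d* := inf{ b ≥ 0 : ∃ c > 0 such that for all r ∈ (0,1], M( X*, r ) ≤ c r^{-b} }. Assume that X* is connected and that there exists r₀ > 0 such that {y ∈ ℝ^d : d∞(y, X*) ≤ r₀} ⊆ X. Then d_z + 1 ≥ d*. -/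
open MeasureTheory ENNReal

/-- The `ℓ∞` covering number of `Y ⊆ ℝ^d` at scale `ε`: the minimal cardinality of a
finite set of centers whose closed `ℓ∞`-balls of radius `ε` cover `Y` (the metric on
`Fin d → ℝ` is the sup metric); it is `⊤` if no finite cover exists. -/
noncomputable def coveringNumber {d : ℕ} (Y : Set (Fin d → ℝ)) (ε : ℝ) : ℝ≥0∞ :=
  ⨅ (s : Finset (Fin d → ℝ)) (_ : Y ⊆ ⋃ y ∈ s, Metric.closedBall y ε), (s.card : ℝ≥0∞)

section CoveringNumber

variable {d : ℕ}

lemma coveringNumber_anti (Y : Set (Fin d → ℝ)) {ε δ : ℝ} (h : ε ≤ δ) :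
    coveringNumber Y δ ≤ coveringNumber Y ε := by
  refine le_iInf₂ fun s hs => iInf₂_le s (hs.trans ?_)
  exact Set.iUnion₂_mono fun y _ => Metric.closedBall_subset_closedBall h

lemma volume_le_coveringNumber_mul (Y : Set (Fin d → ℝ)) {ε : ℝ} (hε : 0 < ε) :
    volume Y ≤ coveringNumber Y ε * ENNReal.ofReal ((2 * ε) ^ d) := by
  have hpos : 0 < (2 * ε) ^ d := by positivity
  rw [← ENNReal.div_le_iff (by simpa using hpos) ENNReal.ofReal_ne_top]
  refine le_iInf₂ fun s hs => ENNReal.div_le_of_le_mul ?_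
  calc volume Y ≤ volume (⋃ y ∈ s, Metric.closedBall y ε) := measure_mono hs
    _ ≤ ∑ y ∈ s, volume (Metric.closedBall y ε) := measure_biUnion_finset_le _ _
    _ = s.card * ENNReal.ofReal ((2 * ε) ^ d) := by
      simp [Real.volume_pi_closedBall _ hε.le]

lemma exists_separated_finset_cover {α : Type*} [PseudoMetricSpace α] {Y : Set α}
    (hY : TotallyBounded Y) {ε : ℝ} (hε : 0 < ε) :
    ∃ s : Finset α, (s : Set α) ⊆ Y ∧ (s : Set α).Pairwise (ε < dist · ·) ∧
      Y ⊆ ⋃ y ∈ s, Metric.closedBall y ε := by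
  lift ε to NNReal using hε.le
  have hε' : ε ≠ 0 := by rintro rfl; simp at hε
  have hpack : Metric.packingNumber ε Y ≠ ⊤ := by
    obtain ⟨N, -, hN, hcov⟩ :=
      Metric.exists_finite_isCover_of_totallyBounded (ε := ε / 2) (by simpa using hε') hY
    have h := Metric.packingNumber_two_mul_le_externalCoveringNumber (ε / 2) Y
    rw [mul_div_cancel₀ ε two_ne_zero] at h
    exact ((h.trans hcov.externalCoveringNumber_le_encard).trans_lt hN.encard_lt_top).ne
  have hfin : (Metric.maximalSeparatedSet ε Y).Finite := by
    rw [← Set.encard_ne_top_iff, Metric.encard_maximalSeparatedSet hpack]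
    exact hpack
  refine ⟨hfin.toFinset, ?_, ?_, ?_⟩
  · simpa using Metric.maximalSeparatedSet_subset
  · intro x hx y hy hxy
    have h := Metric.isSeparated_maximalSeparatedSet (ε := ε) (A := Y)
      (by simpa using hx) (by simpa using hy) hxy
    simp only [edist_nndist] at h
    exact_mod_cast h
  · have h := Metric.isCover_iff_subset_iUnion_closedBall.1
      (Metric.isCover_maximalSeparatedSet hpack)
    simpa using h

lemma coveringNumber_mul_le_volume_cthickening {Y : Set (Fin d → ℝ)}
    (hY : Bornology.IsBounded Y) {s : ℝ} (hs : 0 < s) :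
    coveringNumber Y (2 * s) * ENNReal.ofReal ((2 * s) ^ d) ≤
      volume (Metric.cthickening s Y) := by
  obtain ⟨T, hTY, hsep, hcov⟩ :=
    exists_separated_finset_cover (hY.isCompact_closure.totallyBounded.subset subset_closure)
      (by positivity : 0 < 2 * s)
  calc coveringNumber Y (2 * s) * ENNReal.ofReal ((2 * s) ^ d)
      ≤ T.card * ENNReal.ofReal ((2 * s) ^ d) := by
        gcongr
        exact iInf₂_le T hcov
    _ = ∑ y ∈ T, volume (Metric.closedBall y s) := by
        simp [Real.volume_pi_closedBall _ hs.le]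
    _ = volume (⋃ y ∈ T, Metric.closedBall y s) := by
        refine (measure_biUnion_finset (fun x hx y hy hxy => ?_)
          fun y _ => Metric.isClosed_closedBall.measurableSet).symm
        refine Metric.closedBall_disjoint_closedBall ?_
        have := hsep hx hy hxy
        linarith
    _ ≤ volume (Metric.cthickening s Y) := by
        refine measure_mono (Set.iUnion₂_subset fun y hy => ?_)
        exact Metric.closedBall_subset_cthickening (hTY hy) s

lemma coveringNumber_le_of_volume_le {Y : Set (Fin d → ℝ)} (hY : Bornology.IsBounded Y)
    {s v : ℝ} (hs : 0 < s) (hv : volume (Metric.cthickening s Y) ≤ ENNReal.ofReal v) :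
    coveringNumber Y (2 * s) ≤ ENNReal.ofReal (v / (2 * s) ^ d) := by
  have hpos : 0 < (2 * s) ^ d := by positivity
  rw [ENNReal.ofReal_div_of_pos hpos,
    ENNReal.le_div_iff_mul_le (by simp [hpos]) (by simp)]
  exact (coveringNumber_mul_le_volume_cthickening hY hs).trans hv

lemma coveringNumber_le_of_subset_unitCube {Y : Set (Fin d → ℝ)} (hY : Y ⊆ Set.Icc 0 1)
    {ε : ℝ} (hε : ε ∈ Set.Ioc (0 : ℝ) 1) :
    coveringNumber Y ε ≤ ENNReal.ofReal (3 ^ d / ε ^ d) := by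
  have hs : 0 < ε / 2 := half_pos hε.1
  have hthick : Metric.cthickening (ε / 2) Y ⊆ Set.Icc (-1) 2 := by
    refine (Metric.cthickening_subset_thickening' one_pos (by linarith [hε.2]) Y).trans ?_
    intro y hy
    obtain ⟨x, hx, hxy⟩ := Metric.mem_thickening_iff.1 hy
    have hbound (i : Fin d) : -1 ≤ y i ∧ y i ≤ 2 := by
      have h := abs_lt.1 ((Real.dist_eq _ _ ▸ dist_le_pi_dist y x i).trans_lt hxy)
      have h0 : 0 ≤ x i := (hY hx).1 i
      have h1 : x i ≤ 1 := (hY hx).2 i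
      constructor <;> linarith
    exact ⟨fun i => (hbound i).1, fun i => (hbound i).2⟩
  have h := coveringNumber_le_of_volume_le ((Metric.isBounded_Icc 0 1).subset hY) hs
    (v := 3 ^ d) <| (measure_mono hthick).trans_eq <| by
      rw [Real.volume_Icc_pi, ENNReal.ofReal_pow (by norm_num)]
      norm_num
  rwa [mul_div_cancel₀ ε two_ne_zero] at h

/-- Sliding a subset of the unit cube along the diagonal until it is disjoint from itself
shows that its thickenings gain volume at least linearly in the width. -/
lemma volume_le_mul_volume_cthickening_diff (hd : 0 < d) {K : Set (Fin d → ℝ)}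
    (hK : K ⊆ Set.Icc 0 1) {n : ℕ} (hn : 0 < n) :
    volume K ≤ n * volume (Metric.cthickening (2 / n : ℝ) K \ K) := by
  have : Nonempty (Fin d) := ⟨⟨0, hd⟩⟩
  let h : Fin d → ℝ := fun _ => 2 / n
  let D : Set (Fin d → ℝ) := {x | x + h ∈ K} \ K
  have hstep (m : ℕ) : volume ({x | x + m • h ∈ K} \ K) ≤ m * volume D := by
    induction m with
    | zero => simp
    | succ m ih =>
      have hsub : {x | x + (m + 1) • h ∈ K} \ K ⊆
          (fun x => x + m • h) ⁻¹' D ∪ ({x | x + m • h ∈ K} \ K) := by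
        rintro x ⟨hx, hxK⟩
        by_cases hm : x + m • h ∈ K
        · exact Or.inr ⟨hm, hxK⟩
        · refine Or.inl ⟨?_, hm⟩
          simpa [add_smul, add_assoc] using hx
      calc volume ({x | x + (m + 1) • h ∈ K} \ K)
          ≤ volume ((fun x => x + m • h) ⁻¹' D) + volume ({x | x + m • h ∈ K} \ K) :=
            (measure_mono hsub).trans (measure_union_le _ _)
        _ ≤ volume D + m * volume D := by
            rw [measure_preimage_add_right]
            gcongr
        _ = (m + 1 : ℕ) * volume D := by push_cast; ring
  have hn' : (n : ℝ) ≠ 0 := by positivity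
  have hdisj : {x | x + n • h ∈ K} \ K = (fun x => x + n • h) ⁻¹' K := by
    refine sdiff_eq_left.2 (Set.disjoint_left.2 fun x hx hxK => ?_)
    have h1 : x ⟨0, hd⟩ + n • (2 / n : ℝ) ≤ 1 := (hK hx).2 ⟨0, hd⟩
    have h0 : 0 ≤ x ⟨0, hd⟩ := (hK hxK).1 ⟨0, hd⟩
    rw [nsmul_eq_mul, mul_div_cancel₀ _ hn'] at h1
    linarith
  have hD : D ⊆ Metric.cthickening (2 / n : ℝ) K \ K := by
    rintro x ⟨hx, hxK⟩
    refine ⟨Metric.mem_cthickening_of_dist_le x (x + h) _ K hx ?_, hxK⟩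
    rw [dist_self_add_right, pi_norm_const, Real.norm_of_nonneg (by positivity)]
  calc volume K = volume ({x | x + n • h ∈ K} \ K) := by
        rw [hdisj, measure_preimage_add_right]
    _ ≤ n * volume D := hstep n
    _ ≤ _ := by gcongr

/-- Summing over dyadic shells: if the shells of a family of sets have covering numbers of
order `r ^ (-a)` with `a + 1 ≤ d`, then the volume of the union of the shells below level `r`
is of order `r ^ (d - a)`. -/
lemma volume_diff_iInter_le_of_coveringNumber_shell_le {S : ℝ → Set (Fin d → ℝ)} {a C : ℝ}
    (hC : 0 < C) (had : a + 1 ≤ d)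
    (hS : ∀ r ∈ Set.Ioc (0 : ℝ) 1,
      coveringNumber (S r \ S (r / 2)) (r / 16) ≤ ENNReal.ofReal (C * r ^ (-a)))
    {r : ℝ} (hr : r ∈ Set.Ioc (0 : ℝ) 1) :
    volume (S r \ ⋂ k : ℕ, S (r / 2 ^ k)) ≤ ENNReal.ofReal (2 * C * r ^ (d - a)) := by
  have hr0 := hr.1
  have hshell (ρ : ℝ) (hρ : ρ ∈ Set.Ioc (0 : ℝ) 1) :
      volume (S ρ \ S (ρ / 2)) ≤ ENNReal.ofReal (C * ρ ^ (d - a)) := by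
    have hρ0 := hρ.1
    calc volume (S ρ \ S (ρ / 2))
        ≤ coveringNumber (S ρ \ S (ρ / 2)) (ρ / 16) *
            ENNReal.ofReal ((2 * (ρ / 16)) ^ d) :=
          volume_le_coveringNumber_mul _ (by positivity)
      _ ≤ ENNReal.ofReal (C * ρ ^ (-a)) * ENNReal.ofReal (ρ ^ d) := by
          gcongr
          · exact hS ρ hρ
          · linarith
      _ = ENNReal.ofReal (C * ρ ^ (d - a)) := by
          rw [← ENNReal.ofReal_mul (by positivity), mul_assoc, ← Real.rpow_natCast,
            ← Real.rpow_add hρ0, neg_add_eq_sub]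
  have hterm (k : ℕ) : volume (S (r / 2 ^ k) \ S (r / 2 ^ (k + 1))) ≤
      ENNReal.ofReal (C * r ^ (d - a) * (1 / 2) ^ k) := by
    have hk : r / 2 ^ k ∈ Set.Ioc (0 : ℝ) 1 :=
      ⟨by positivity, (div_le_self hr0.le (one_le_pow₀ one_le_two)).trans hr.2⟩
    have h := hshell _ hk
    rw [div_div, ← pow_succ] at h
    refine h.trans (ENNReal.ofReal_le_ofReal ?_)
    have hpow : ((1 / 2 : ℝ) ^ k) ^ (d - a : ℝ) ≤ (1 / 2) ^ k :=
      Real.rpow_le_self_of_le_one (by positivity)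
        (pow_le_one₀ (by norm_num) (by norm_num)) (by linarith)
    have hdiv : r / 2 ^ k = r * (1 / 2) ^ k := by
      rw [div_pow, one_pow, mul_one_div]
    rw [hdiv, Real.mul_rpow hr0.le (by positivity), ← mul_assoc]
    gcongr
  have hsub : S r \ ⋂ k : ℕ, S (r / 2 ^ k) ⊆
      ⋃ k : ℕ, S (r / 2 ^ k) \ S (r / 2 ^ (k + 1)) := by
    rintro x ⟨hx, hxi⟩
    by_contra hcon
    refine hxi (Set.mem_iInter.2 fun k => ?_)
    induction k with
    | zero => simpa using hx
    | succ k ih =>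
      by_contra hk
      exact hcon (Set.mem_iUnion.2 ⟨k, ih, hk⟩)
  have hnonneg : 0 ≤ C * r ^ (d - a) := by positivity
  calc volume (S r \ ⋂ k : ℕ, S (r / 2 ^ k))
      ≤ ∑' k : ℕ, volume (S (r / 2 ^ k) \ S (r / 2 ^ (k + 1))) :=
        (measure_mono hsub).trans (measure_iUnion_le _)
    _ ≤ ∑' k : ℕ, ENNReal.ofReal (C * r ^ (d - a) * (1 / 2) ^ k) :=
        ENNReal.tsum_le_tsum hterm
    _ = ENNReal.ofReal (2 * C * r ^ (d - a)) := by
        rw [← ENNReal.ofReal_tsum_of_nonneg (fun k => by positivity)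
          (summable_geometric_two.mul_left _), tsum_mul_left, tsum_geometric_two]
        ring_nf

/-- A bounded set in the unit cube whose collars `cthickening t K \ K` have volume
`O(t ^ p)` with `p > 1` is a null set. -/
lemma volume_eq_zero_of_volume_cthickening_diff_le (hd : 0 < d) {K : Set (Fin d → ℝ)}
    (hK : K ⊆ Set.Icc 0 1) {p c t₀ : ℝ} (hp : 1 < p) (ht₀ : 0 < t₀)
    (h : ∀ t ∈ Set.Ioc 0 t₀, volume (Metric.cthickening t K \ K) ≤ ENNReal.ofReal (c * t ^ p)) :
    volume K = 0 := by
  have hlim : Filter.Tendsto (fun n : ℕ => ENNReal.ofReal (2 * c * (2 / n : ℝ) ^ (p - 1)))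
      Filter.atTop (nhds 0) := by
    have h2 : Filter.Tendsto (fun n : ℕ => (2 / n : ℝ)) Filter.atTop (nhds 0) :=
      tendsto_const_div_atTop_nhds_zero_nat 2
    have := (h2.rpow_const (p := p - 1) (Or.inr (by linarith))).const_mul (2 * c)
    rw [Real.zero_rpow (by linarith), mul_zero] at this
    simpa using ENNReal.tendsto_ofReal this
  refine le_antisymm (ge_of_tendsto hlim ?_) zero_le
  have hsmall : ∀ᶠ n : ℕ in Filter.atTop, (2 / n : ℝ) < t₀ :=
    (tendsto_const_div_atTop_nhds_zero_nat 2).eventually (gt_mem_nhds ht₀)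
  filter_upwards [hsmall, Filter.eventually_gt_atTop 0] with n hnt hn
  have ht : (0 : ℝ) < 2 / n := by positivity
  calc volume K ≤ n * volume (Metric.cthickening (2 / n : ℝ) K \ K) :=
        volume_le_mul_volume_cthickening_diff hd hK hn
    _ ≤ n * ENNReal.ofReal (c * (2 / n : ℝ) ^ p) := by
        gcongr
        exact h _ ⟨ht, hnt.le⟩
    _ = ENNReal.ofReal (2 * c * (2 / n : ℝ) ^ (p - 1)) := by
        rw [← ENNReal.ofReal_natCast, ← ENNReal.ofReal_mul (by positivity),
          Real.rpow_sub_one ht.ne']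
        congr 1
        field_simp

/-- If the collars of a set in the unit cube have volume `O(t ^ (d - a))` with `a + 1 < d`,
then its covering numbers are `O(r ^ (-a))`. -/
lemma exists_coveringNumber_le_of_volume_cthickening_diff_le (hd : 0 < d)
    {K : Set (Fin d → ℝ)} (hK : K ⊆ Set.Icc 0 1) {a c t₀ : ℝ} (hc : 0 < c) (had : a + 1 < d)
    (ht₀ : 0 < t₀)
    (h : ∀ t ∈ Set.Ioc 0 t₀,
      volume (Metric.cthickening t K \ K) ≤ ENNReal.ofReal (c * t ^ (d - a))) :
    ∃ c' > (0 : ℝ), ∀ r ∈ Set.Ioc (0 : ℝ) 1,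
      coveringNumber K r ≤ ENNReal.ofReal (c' * r ^ (-a)) := by
  have hnull : volume K = 0 :=
    volume_eq_zero_of_volume_cthickening_diff_le hd hK (by linarith) ht₀ h
  set κ : ℝ := min (1 / 2) t₀
  have hκ0 : 0 < κ := lt_min (by norm_num) ht₀
  refine ⟨c * κ ^ (-a) / 2 ^ d, by positivity, fun r hr => ?_⟩
  have hr0 := hr.1
  have hs : 0 < κ * r := by positivity
  have hst : κ * r ≤ t₀ :=
    (mul_le_of_le_one_right hκ0.le hr.2).trans (min_le_right _ _)
  have hvol : volume (Metric.cthickening (κ * r) K) ≤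
      ENNReal.ofReal (c * (κ * r) ^ (d - a)) := by
    rw [← measure_sdiff_null hnull]
    exact h _ ⟨hs, hst⟩
  have h2s : 2 * (κ * r) ≤ r := by
    have : κ * r ≤ 1 / 2 * r := by gcongr; exact min_le_left _ _
    linarith
  calc coveringNumber K r ≤ coveringNumber K (2 * (κ * r)) := coveringNumber_anti K h2s
    _ ≤ ENNReal.ofReal (c * (κ * r) ^ (d - a) / (2 * (κ * r)) ^ d) :=
        coveringNumber_le_of_volume_le ((Metric.isBounded_Icc 0 1).subset hK) hs hvol
    _ = ENNReal.ofReal (c * κ ^ (-a) / 2 ^ d * r ^ (-a)) := by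
        congr 1
        rw [mul_pow 2, sub_eq_neg_add, Real.rpow_add hs, Real.rpow_natCast,
          Real.mul_rpow hκ0.le hr0.le]
        field_simp

end CoveringNumber

/-- **Relation between the zooming dimension and the dimension of the maximizer set.**
`ℝ^d` carries the `ℓ∞` metric.  Let `X ⊆ [0,1]^d`, `f : X → ℝ` an `L`-Lipschitz function
(w.r.t. `ℓ∞`) attaining its maximum `f*` at `x*`; set `Δ x = f* − f x`,
`X_r = {x ∈ X : Δ x ≤ r}` and `X* = {x ∈ X : f x = f*}`.  Define the zooming dimension
`d_z = inf{a ≥ 0 : ∃ C > 0, ∀ r ∈ (0,1], M(X_r \ X_{r/2}, r/16) ≤ C r^{-a}}` and the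
optimal-set dimension `d* = inf{b ≥ 0 : ∃ c > 0, ∀ r ∈ (0,1], M(X*, r) ≤ c r^{-b}}`.
If `X*` is connected and its closed `r₀`-thickening is contained in `X` for some
`r₀ > 0`, then `d_z + 1 ≥ d*`. -/
theorem zooming_dim_vs_optimal_dim {d : ℕ} (hd : 0 < d) (X : Set (Fin d → ℝ))
    (hX : X ⊆ Set.Icc 0 1)
    (f : (Fin d → ℝ) → ℝ) (L : ℝ) (hL : 0 < L)
    (hLip : ∀ x ∈ X, ∀ y ∈ X, |f x - f y| ≤ L * dist x y)
    (xstar : Fin d → ℝ) (hxstar : xstar ∈ X) (hmax : ∀ x ∈ X, f x ≤ f xstar)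
    (Xr : ℝ → Set (Fin d → ℝ)) (hXr : ∀ r, Xr r = {x ∈ X | f xstar - f x ≤ r})
    (Xstar : Set (Fin d → ℝ)) (hXstar : Xstar = {x ∈ X | f x = f xstar})
    (dz dstar : ℝ)
    (hdz : dz = sInf {a : ℝ | 0 ≤ a ∧ ∃ C > (0:ℝ), ∀ r ∈ Set.Ioc (0:ℝ) 1,
      coveringNumber (Xr r \ Xr (r / 2)) (r / 16) ≤ ENNReal.ofReal (C * r ^ (-a))})
    (hdstar : dstar = sInf {b : ℝ | 0 ≤ b ∧ ∃ c > (0:ℝ), ∀ r ∈ Set.Ioc (0:ℝ) 1,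
      coveringNumber Xstar r ≤ ENNReal.ofReal (c * r ^ (-b))})
    (hconn : IsConnected Xstar)
    (r₀ : ℝ) (hr₀ : 0 < r₀) (hthick : Metric.cthickening r₀ Xstar ⊆ X) :
    dz + 1 ≥ dstar := by
  have hstarX : Xstar ⊆ X := hXstar ▸ Set.sep_subset _ _
  have hcollar (t : ℝ) (ht0 : 0 < t) (ht : t ≤ r₀) :
      Metric.cthickening t Xstar ⊆ Xr (L * t) := by
    intro y hy
    have hyX : y ∈ X := hthick (Metric.cthickening_mono ht _ hy)
    rw [hXr]
    refine ⟨hyX, le_of_forall_pos_lt_add fun ε hε => ?_⟩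
    have hlt : t < t + ε / L := lt_add_of_pos_right t (by positivity)
    obtain ⟨x, hx, hxy⟩ := Metric.mem_thickening_iff.1
      (Metric.cthickening_subset_thickening' (ht0.trans hlt) hlt _ hy)
    rw [hXstar] at hx
    calc f xstar - f y = f x - f y := by rw [hx.2]
      _ ≤ |f x - f y| := le_abs_self _
      _ ≤ L * dist x y := hLip x hx.1 y hyX
      _ < L * (t + ε / L) := by rw [dist_comm]; gcongr
      _ = L * t + ε := by field_simp
  have hinter (r : ℝ) : ⋂ k : ℕ, Xr (r / 2 ^ k) ⊆ Xstar := by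
    intro x hx
    simp only [hXr, Set.mem_iInter, Set.mem_ofPred_eq] at hx
    rw [hXstar]
    refine ⟨(hx 0).1, le_antisymm (hmax x (hx 0).1) (sub_nonpos.1 ?_)⟩
    have hlim : Filter.Tendsto (fun k : ℕ => r / 2 ^ k) Filter.atTop (nhds 0) := by
      simpa [div_eq_mul_inv] using
        (tendsto_inv_atTop_zero.comp
          (tendsto_pow_atTop_atTop_of_one_lt (one_lt_two (α := ℝ)))).const_mul r
    exact ge_of_tendsto' hlim fun k => (hx k).2
  have hmain (a : ℝ) (ha : 0 ≤ a) (C : ℝ) (hC : 0 < C)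
      (hcov : ∀ r ∈ Set.Ioc (0:ℝ) 1,
        coveringNumber (Xr r \ Xr (r / 2)) (r / 16) ≤ ENNReal.ofReal (C * r ^ (-a))) :
      ∃ c > (0:ℝ), ∀ r ∈ Set.Ioc (0:ℝ) 1,
        coveringNumber Xstar r ≤ ENNReal.ofReal (c * r ^ (-(a + 1))) := by
    rcases lt_or_ge (a + 1) d with had | had
    · obtain ⟨c, hc, h⟩ := exists_coveringNumber_le_of_volume_cthickening_diff_le hd
        (hstarX.trans hX) (a := a) (c := 2 * C * L ^ (d - a)) (t₀ := min r₀ (1 / L))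
        (by positivity) had (by positivity) fun t ht => by
          have ht0 := ht.1
          have hLt : L * t ∈ Set.Ioc (0 : ℝ) 1 :=
            ⟨by positivity, (le_div_iff₀' hL).1 (ht.2.trans (min_le_right _ _))⟩
          calc volume (Metric.cthickening t Xstar \ Xstar)
              ≤ volume (Xr (L * t) \ ⋂ k : ℕ, Xr (L * t / 2 ^ k)) :=
                measure_mono (Set.sdiff_subset_sdiff
                  (hcollar t ht0 (ht.2.trans (min_le_left _ _))) (hinter _))
            _ ≤ ENNReal.ofReal (2 * C * (L * t) ^ (d - a)) :=
                volume_diff_iInter_le_of_coveringNumber_shell_le hC had.le hcov hLt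
            _ = _ := by rw [Real.mul_rpow hL.le ht0.le, mul_assoc _ (L ^ _)]
      refine ⟨c, hc, fun r hr => (h r hr).trans (ENNReal.ofReal_le_ofReal ?_)⟩
      gcongr ?_ * ?_
      exact Real.rpow_le_rpow_of_exponent_ge hr.1 hr.2 (by linarith)
    · refine ⟨3 ^ d, by positivity, fun r hr =>
        (coveringNumber_le_of_subset_unitCube (hstarX.trans hX) hr).trans
          (ENNReal.ofReal_le_ofReal ?_)⟩
      rw [div_eq_mul_inv, ← Real.rpow_natCast r, ← Real.rpow_neg hr.1.le]
      gcongr ?_ * ?_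
      exact Real.rpow_le_rpow_of_exponent_ge hr.1 hr.2 (by linarith)
  have hne : {a : ℝ | 0 ≤ a ∧ ∃ C > (0:ℝ), ∀ r ∈ Set.Ioc (0:ℝ) 1,
      coveringNumber (Xr r \ Xr (r / 2)) (r / 16) ≤
        ENNReal.ofReal (C * r ^ (-a))}.Nonempty := by
    refine ⟨d, Nat.cast_nonneg d, 48 ^ d, by positivity, fun r hr => ?_⟩
    have hr0 := hr.1
    have hsub : Xr r \ Xr (r / 2) ⊆ Set.Icc 0 1 := by
      rw [hXr r]
      exact fun x hx => hX hx.1.1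
    refine (coveringNumber_le_of_subset_unitCube hsub
      ⟨by positivity, by linarith [hr.2]⟩).trans_eq ?_
    congr 1
    rw [Real.rpow_neg hr0.le, Real.rpow_natCast, ← div_eq_mul_inv, ← div_pow, ← div_pow]
    congr 1
    field_simp
    norm_num
  rw [ge_iff_le, ← sub_le_iff_le_add, hdz]
  refine le_csInf hne ?_
  rintro a ⟨ha, C, hC, hcov⟩
  rw [sub_le_iff_le_add, hdstar]
  exact csInf_le ⟨0, fun b hb => hb.1⟩ ⟨by linarith, hmain a ha C hC hcov⟩
end

section
/- Let X ⊆ ℝ^d, let L > 0, and let f : X → ℝ be one-sided L-Lipschitz and attain its maximum f* on X; set X* := {x ∈ X : f(x) = f*} and Δ_f := inf{ f* − f(x) : x ∈ X, f(x) < f* } (with Δ_f = +∞ if X = X*). Assume Δ_f > 0, set r := Δ_f/(4L), and let S ⊆ X be a forward cover of X at scale r: for every x ∈ X there exists a ∈ S with a ⪯ x and ‖x − a‖∞ ≤ r. Then S ∩ X* ≠ ∅; i.e., S contains a maximizer of f. -/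
/-- **Positive-gap reduction: a forward cover contains a maximizer.**
`ℝ^d` carries the `ℓ∞` metric (the sup metric on `Fin d → ℝ`), and `≤` is the
coordinatewise order.  Let `f : X → ℝ` be one-sided `L`-Lipschitz and attain its
maximum `f*` at `x* ∈ X`.  Suppose the global suboptimality gap is at least
`Δf > 0`, i.e. every `x ∈ X` with `f x < f*` has `f* − f x ≥ Δf` (this covers the
convention `Δf = +∞` when every point is optimal).  If `S ⊆ X` is a forward cover
of `X` at scale `r = Δf/(4L)` — for every `x ∈ X` there is `a ∈ S` with `a ⪯ x`
and `‖x − a‖∞ ≤ Δf/(4L)` — then `S` contains a maximizer of `f`. -/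
theorem onesided_positive_gap_cover_contains_maximizer {d : ℕ}
    (X S : Set (Fin d → ℝ)) (hSX : S ⊆ X)
    (L : ℝ) (hL : 0 < L) (f : (Fin d → ℝ) → ℝ)
    (hf : ∀ x ∈ X, ∀ y ∈ X, x ≤ y → f y - f x ≤ L * dist y x)
    (xstar : Fin d → ℝ) (hxstar : xstar ∈ X) (hmax : ∀ x ∈ X, f x ≤ f xstar)
    (Δf : ℝ) (hΔpos : 0 < Δf)
    (hΔ : ∀ x ∈ X, f x < f xstar → Δf ≤ f xstar - f x)
    (hcover : ∀ x ∈ X, ∃ a ∈ S, a ≤ x ∧ dist x a ≤ Δf / (4 * L)) :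
    ∃ a ∈ S, f a = f xstar := by
  obtain ⟨a, haS, hle, hdist⟩ := hcover xstar hxstar
  have haX := hSX haS
  refine ⟨a, haS, (hmax a haX).antisymm ?_⟩
  by_contra! hlt
  have hgap := hΔ a haX hlt
  have hlip := hf a haX xstar hxstar hle
  have hscale : L * dist xstar a ≤ Δf / 4 := calc
    L * dist xstar a ≤ L * (Δf / (4 * L)) := by gcongr
    _ = Δf / 4 := by field_simp
  linarith
end
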